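/- For every integer k ≥ 1, S_{χ₁,χ₂}(1, k·q₁q₂) = 0. -/

import Mathlib

open scoped MatrixGroups
open CongruenceSubgroup Matrix

/-- The first Bernoulli function `B₁(x)`: equal to `x - ⌊x⌋ - 1/2` for non-integral `x`
and `0` for integral `x`. -/
noncomputable def B1 (x : ℝ) : ℝ := if Int.fract x = 0 then 0 else Int.fract x - 1/2

/-- The newform Dedekind sum `S_{χ₁,χ₂}(a, c)`. -/
noncomputable def ded {q₁ q₂ : ℕ} (χ₁ : DirichletCharacter ℂ q₁)
    (χ₂ : DirichletCharacter ℂ q₂) (a c : ℤ) : ℂ :=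
  ∑ j ∈ Finset.range c.toNat, ∑ n ∈ Finset.range q₁,
    (starRingEnd ℂ) (χ₂ (j : ZMod q₂)) * (starRingEnd ℂ) (χ₁ (n : ZMod q₁)) *
      ((B1 ((j : ℝ) / (c : ℝ)) * B1 ((n : ℝ) / (q₁ : ℝ) + (a : ℝ) * (j : ℝ) / (c : ℝ)) : ℝ) : ℂ)

theorem aux_sum_mul (f : ℕ → ℂ) (q m : ℕ) :
    ∑ j ∈ Finset.range (q * m), f j
      = ∑ s ∈ Finset.range q, ∑ r ∈ Finset.range m, f (s * m + r) := by
  induction q with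
  | zero => simp
  | succ q ih => rw [Nat.succ_mul, Finset.sum_range_add, ih, Finset.sum_range_succ]

theorem aux_shift (q n : ℕ) :
    ∑ s ∈ Finset.range q, ((((n + s) % q : ℕ) : ℂ)) = ∑ s ∈ Finset.range q, (((s % q : ℕ) : ℂ)) := by
  induction n with
  | zero => simp
  | succ n ih =>
    rw [← ih]
    have h1 := Finset.sum_range_succ (fun s => (((n + s) % q : ℕ) : ℂ)) q
    have h2 := Finset.sum_range_succ' (fun s => (((n + s) % q : ℕ) : ℂ)) q
    rw [h1] at h2
    simp only [Nat.add_mod_right, add_zero] at h2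
    have h3 := add_right_cancel h2
    rw [h3]
    refine Finset.sum_congr rfl fun s _ => ?_
    rw [add_right_comm, add_assoc]

theorem aux_char {q : ℕ} (hq : 1 < q) (χ : DirichletCharacter ℂ q) (h : χ.IsPrimitive) :
    ∑ n ∈ Finset.range q, (starRingEnd ℂ) (χ (n : ZMod q)) = 0 := by
  haveI : NeZero q := ⟨by omega⟩
  have hne : χ ≠ 1 := by
    rintro rfl
    have h' : (1 : DirichletCharacter ℂ q).conductor = q := h
    rw [DirichletCharacter.conductor_one] at h'
    omega
  rw [← map_sum]
  have h0 := MulChar.sum_eq_zero_of_ne_one hne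
  have : ∑ n ∈ Finset.range q, χ (n : ZMod q) = ∑ a : ZMod q, χ a := by
    refine Finset.sum_bij' (fun n _ => (n : ZMod q)) (fun a _ => a.val) ?_ ?_ ?_ ?_ ?_
    · simp
    · intro a _; simpa using ZMod.val_lt a
    · intro a ha; exact ZMod.val_cast_of_lt (by simpa using ha)
    · intro a _; simp
    · simp
  rw [this, h0, map_zero]

theorem aux_B1 (q m n s r : ℕ) (hq : 0 < q) (hr : 0 < r) (hrm : r < m) :
    B1 ((n : ℝ) / q + ((s * m + r : ℕ) : ℝ) / ((q * m : ℕ) : ℝ))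
      = (((n + s) % q : ℕ) : ℝ) / q + (r : ℝ) / ((q * m : ℕ) : ℝ) - 1 / 2 := by
  have hm : 0 < m := by omega
  have hq' : (0 : ℝ) < q := by exact_mod_cast hq
  have hm' : (0 : ℝ) < m := by exact_mod_cast hm
  have hr' : (0 : ℝ) < r := by exact_mod_cast hr
  have hdiv : ((n : ℝ) + s) = q * (((n + s) / q : ℕ) : ℝ) + (((n + s) % q : ℕ) : ℝ) := by
    exact_mod_cast (Nat.div_add_mod (n + s) q).symm
  have hv : (((n + s) % q : ℕ) : ℝ) + 1 ≤ q := by exact_mod_cast Nat.mod_lt _ hq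
  have hv0 : (0 : ℝ) ≤ (((n + s) % q : ℕ) : ℝ) := by positivity
  generalize (((n + s) % q : ℕ) : ℝ) = v at *
  have hrm' : (r : ℝ) < m := by exact_mod_cast hrm
  have hx : (n : ℝ) / q + ((s * m + r : ℕ) : ℝ) / ((q * m : ℕ) : ℝ)
      = (v / q + (r : ℝ) / ((q * m : ℕ) : ℝ)) + (((n + s) / q : ℕ) : ℝ) := by
    simp only [Nat.cast_add, Nat.cast_mul]
    field_simp
    linear_combination (m : ℝ) * hdiv
  have hpos : 0 < v / q + (r : ℝ) / ((q * m : ℕ) : ℝ) := by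
    push_cast; positivity
  have hlt : v / q + (r : ℝ) / ((q * m : ℕ) : ℝ) < 1 := by
    push_cast
    have : v / q + (r : ℝ) / (q * m) = (v + r / m) / q := by field_simp
    rw [this, div_lt_one hq']
    have : (r : ℝ) / m < 1 := by rwa [div_lt_one hm']
    linarith
  have hf : Int.fract ((n : ℝ) / q + ((s * m + r : ℕ) : ℝ) / ((q * m : ℕ) : ℝ))
      = v / q + (r : ℝ) / ((q * m : ℕ) : ℝ) := by
    rw [hx, Int.fract_add_natCast]
    exact Int.fract_eq_self.2 ⟨hpos.le, hlt⟩
  unfold B1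
  rw [hf, if_neg hpos.ne']

/-- `S_{χ₁,χ₂}(1, k·q₁q₂) = 0` for all `k ≥ 1`. -/
theorem ded_one_multiple_eq_zero {q₁ q₂ : ℕ} (hq₁ : 1 < q₁) (hq₂ : 1 < q₂)
    (χ₁ : DirichletCharacter ℂ q₁) (χ₂ : DirichletCharacter ℂ q₂)
    (h₁ : χ₁.IsPrimitive) (h₂ : χ₂.IsPrimitive)
    (hpar : χ₁ (-1) * χ₂ (-1) = 1) :
    ∀ k : ℤ, 1 ≤ k → ded χ₁ χ₂ 1 (k * ((q₁ * q₂ : ℕ) : ℤ)) = 0 := by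
  intro k hk
  obtain ⟨k, rfl⟩ := Int.eq_ofNat_of_zero_le (show 0 ≤ k by omega)
  have hc : ((k : ℤ) * ((q₁ * q₂ : ℕ) : ℤ)) = ((q₁ * (k * q₂) : ℕ) : ℤ) := by
    push_cast; ring
  rw [hc]
  have hX := aux_char hq₁ χ₁ h₁
  have hY : ∑ r ∈ Finset.range (k * q₂), (starRingEnd ℂ) (χ₂ (r : ZMod q₂)) = 0 := by
    rw [aux_sum_mul (fun r => (starRingEnd ℂ) (χ₂ (r : ZMod q₂)))]
    simp [aux_char hq₂ χ₂ h₂]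
  have hper : ∀ s r : ℕ, χ₂ ((s * (k * q₂) + r : ℕ) : ZMod q₂) = χ₂ (r : ZMod q₂) := by
    intro s r; simp
  have hz : χ₂ ((0 : ℕ) : ZMod q₂) = 0 := by
    haveI : Fact (1 < q₂) := ⟨hq₂⟩
    rw [Nat.cast_zero]
    exact MulChar.map_zero χ₂
  generalize k * q₂ = m at *
  unfold ded
  rw [Int.toNat_natCast, aux_sum_mul]
  have key : ∀ s ∈ Finset.range q₁, ∀ r ∈ Finset.range m, ∀ n ∈ Finset.range q₁,
      (starRingEnd ℂ) (χ₂ ((s * m + r : ℕ) : ZMod q₂)) * (starRingEnd ℂ) (χ₁ (n : ZMod q₁)) *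
      ((B1 (((s * m + r : ℕ) : ℝ) / (((q₁ * m : ℕ) : ℤ) : ℝ)) *
        B1 ((n : ℝ) / (q₁ : ℝ) + ((1 : ℤ) : ℝ) * ((s * m + r : ℕ) : ℝ) / (((q₁ * m : ℕ) : ℤ) : ℝ)) : ℝ) : ℂ)
      = (starRingEnd ℂ) (χ₂ (r : ZMod q₂)) * ((starRingEnd ℂ) (χ₁ (n : ZMod q₁)) *
        (((s : ℂ) / q₁ * ((((n + s) % q₁ : ℕ) : ℂ) / q₁)))) +
        (starRingEnd ℂ) (χ₁ (n : ZMod q₁)) * ((starRingEnd ℂ) (χ₂ (r : ZMod q₂)) *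
        (((r : ℂ) / ((q₁ * m : ℕ) : ℂ) - 1 / 2) * ((s : ℂ) / q₁ + ((r : ℂ) / ((q₁ * m : ℕ) : ℂ) - 1 / 2)))) +
        (starRingEnd ℂ) (χ₁ (n : ZMod q₁)) * ((starRingEnd ℂ) (χ₂ (r : ZMod q₂)) *
        (((r : ℂ) / ((q₁ * m : ℕ) : ℂ) - 1 / 2) / q₁)) * (((n + s) % q₁ : ℕ) : ℂ) := by
    intro s hs r hr n hn
    rw [hper]
    rcases Nat.eq_zero_or_pos r with rfl | hr0
    · simp only [hz, map_zero, zero_mul, mul_zero, add_zero]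
    · have e1 := aux_B1 q₁ m n s r (by omega) hr0 (Finset.mem_range.1 hr)
      have e2 := aux_B1 q₁ m 0 s r (by omega) hr0 (Finset.mem_range.1 hr)
      rw [Nat.zero_add, Nat.mod_eq_of_lt (Finset.mem_range.1 hs), Nat.cast_zero, zero_div,
        zero_add] at e2
      rw [Int.cast_one, one_mul, Int.cast_natCast, e1, e2]
      simp only [Complex.ofReal_mul, Complex.ofReal_sub, Complex.ofReal_add, Complex.ofReal_div,
        Complex.ofReal_natCast, Complex.ofReal_one, Complex.ofReal_ofNat]
      ring
  rw [Finset.sum_congr rfl fun s hs => Finset.sum_congr rfl fun r hr =>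
    Finset.sum_congr rfl fun n hn => key s hs r hr n hn]
  simp only [Finset.sum_add_distrib]
  have z1 : ∀ s ∈ Finset.range q₁, ∑ r ∈ Finset.range m, ∑ n ∈ Finset.range q₁,
      (starRingEnd ℂ) (χ₂ (r : ZMod q₂)) * ((starRingEnd ℂ) (χ₁ (n : ZMod q₁)) *
        (((s : ℂ) / q₁ * ((((n + s) % q₁ : ℕ) : ℂ) / q₁)))) = 0 := by
    intro s _
    simp only [← Finset.mul_sum]
    rw [← Finset.sum_mul, hY, zero_mul]
  rw [Finset.sum_eq_zero z1]
  simp only [← Finset.sum_mul, hX, zero_mul, Finset.sum_const_zero, zero_add]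
  rw [Finset.sum_comm]
  refine Finset.sum_eq_zero fun r _ => ?_
  rw [Finset.sum_comm]
  simp only [← Finset.mul_sum, aux_shift]
  simp only [← Finset.sum_mul, hX, zero_mul]
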